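/- Let I be a (2,∞)-instance (every firm has at most two acceptable workers) or an (∞,2)-instance (every worker has at most two acceptable firms), and let σ be any offering order on I. Then sfda(I,σ)=spe(I,σ), i.e., the output of the sequentially fixing deferred acceptance algorithm equals the SPE matching. -/

import Mathlib

namespace SeqMatching

/-- A matching instance `I = (P, Q, E, ≻)`: firms `P`, workers `Q`, a finite set `E`
of acceptable pairs, and strict preferences encoded by rank functions
(lower rank = more preferred), injective on acceptable partners.
For a firm `p`, `q ≻_p q'` means `rankP p q < rankP p q'`; symmetrically for workers. -/
structure MI (P Q : Type) where
  E : Finset (P × Q)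
  rankP : P → Q → ℕ
  rankQ : Q → P → ℕ
  injP : ∀ p q q', (p, q) ∈ E → (p, q') ∈ E → rankP p q = rankP p q' → q = q'
  injQ : ∀ q p p', (p, q) ∈ E → (p', q) ∈ E → rankQ q p = rankQ q p' → p = p'

namespace MI

variable {P Q : Type}

/-- `μ` is a matching in `I`: a subset of `E` in which every firm and every worker
occurs in at most one pair. -/
def IsMatching (I : MI P Q) (μ : Finset (P × Q)) : Prop :=
  μ ⊆ I.E ∧ ∀ e ∈ μ, ∀ f ∈ μ, (e.1 = f.1 ∨ e.2 = f.2) → e = f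

/-- `μ(q) ⪰_q p`: worker `q` is matched in `μ` to `p` or to a firm she strictly prefers to `p`. -/
def WAtLeast (I : MI P Q) (μ : Finset (P × Q)) (q : Q) (p : P) : Prop :=
  ∃ p', (p', q) ∈ μ ∧ (p' = p ∨ I.rankQ q p' < I.rankQ q p)

/-- `p ≻_q μ(q)`: worker `q` is unmatched in `μ` or matched to a firm strictly less preferred than `p`. -/
def WBelow (I : MI P Q) (μ : Finset (P × Q)) (q : Q) (p : P) : Prop :=
  ∀ p', (p', q) ∈ μ → I.rankQ q p < I.rankQ q p'

/-- `q ≻_p μ(p)`: firm `p` is unmatched in `μ` or matched to a worker strictly less preferred than `q`. -/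
def FBelow (I : MI P Q) (μ : Finset (P × Q)) (p : P) (q : Q) : Prop :=
  ∀ q', (p, q') ∈ μ → I.rankP p q < I.rankP p q'

/-- the acceptable pair `e = (p, q)` blocks `μ`. -/
def Blocks (I : MI P Q) (μ : Finset (P × Q)) (e : P × Q) : Prop :=
  e ∈ I.E ∧ I.FBelow μ e.1 e.2 ∧ I.WBelow μ e.2 e.1

/-- `μ` is a stable matching in `I`. -/
def IsStable (I : MI P Q) (μ : Finset (P × Q)) : Prop :=
  I.IsMatching μ ∧ ∀ e, ¬ I.Blocks μ e

/-- `μ(q) ⪰_q μ'(q)`: worker `q` weakly prefers `μ` to `μ'`. -/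
def WGe (I : MI P Q) (μ μ' : Finset (P × Q)) (q : Q) : Prop :=
  ∀ p', (p', q) ∈ μ' → I.WAtLeast μ q p'

/-- `μ` is the Q-optimal (worker-optimal) stable matching of `I`. -/
def IsQOpt (I : MI P Q) (μ : Finset (P × Q)) : Prop :=
  I.IsStable μ ∧ ∀ μ', I.IsStable μ' → ∀ q, I.WGe μ μ' q

open scoped Classical in
/-- the Q-optimal stable matching `qopt(I)` (it exists and is unique by Gale–Shapley). -/
noncomputable def qopt (I : MI P Q) : Finset (P × Q) :=
  if h : ∃ μ, I.IsQOpt μ then h.choose else ∅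

/-- `q` is the most preferred worker on `p`'s list. -/
def TopForFirm (I : MI P Q) (p : P) (q : Q) : Prop :=
  (p, q) ∈ I.E ∧ ∀ q', (p, q') ∈ I.E → I.rankP p q ≤ I.rankP p q'

/-- `p` is the most preferred firm on `q`'s list. -/
def TopForWorker (I : MI P Q) (q : Q) (p : P) : Prop :=
  (p, q) ∈ I.E ∧ ∀ p', (p', q) ∈ I.E → I.rankQ q p ≤ I.rankQ q p'

variable [DecidableEq P] [DecidableEq Q]

/-- a (2,∞)-instance: every firm has at most two acceptable workers. -/
def FirmsDegTwo (I : MI P Q) : Prop :=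
  ∀ p : P, (I.E.filter (fun f => f.1 = p)).card ≤ 2

/-- an (∞,2)-instance: every worker has at most two acceptable firms. -/
def WorkersDegTwo (I : MI P Q) : Prop :=
  ∀ q : Q, (I.E.filter (fun f => f.2 = q)).card ≤ 2

/-- the deletion `I ∖ e`. -/
def del (I : MI P Q) (e : P × Q) : MI P Q where
  E := I.E.erase e
  rankP := I.rankP
  rankQ := I.rankQ
  injP := fun p q q' h h' hr =>
    I.injP p q q' (Finset.mem_of_mem_erase h) (Finset.mem_of_mem_erase h') hr
  injQ := fun q p p' h h' hr =>
    I.injQ q p p' (Finset.mem_of_mem_erase h) (Finset.mem_of_mem_erase h') hr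

/-- the contraction `I / e`: all pairs containing the firm or the worker of `e` are removed. -/
def contr (I : MI P Q) (e : P × Q) : MI P Q where
  E := I.E.filter (fun f => f.1 ≠ e.1 ∧ f.2 ≠ e.2)
  rankP := I.rankP
  rankQ := I.rankQ
  injP := fun p q q' h h' hr =>
    I.injP p q q' (Finset.filter_subset _ _ h) (Finset.filter_subset _ _ h') hr
  injQ := fun q p p' h h' hr =>
    I.injQ q p p' (Finset.filter_subset _ _ h) (Finset.filter_subset _ _ h') hr

/-- `σ` is an offering order on `I`: an enumeration of `E` without repetition, consistent
with the firms' preferences (if `e ≻_p f` for two offers of the same firm, `e` comes first). -/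
def IsOfferOrder (I : MI P Q) (σ : List (P × Q)) : Prop :=
  σ.Nodup ∧ (∀ e, e ∈ σ ↔ e ∈ I.E) ∧
    ∀ e f, e ∈ σ → f ∈ σ → e.1 = f.1 → I.rankP e.1 e.2 < I.rankP f.1 f.2 →
      σ.idxOf e < σ.idxOf f

/-- restriction `σ / e` of the order `σ` to the pairs of `I / e`. -/
def contrO (σ : List (P × Q)) (e : P × Q) : List (P × Q) :=
  σ.filter (fun f => decide (f.1 ≠ e.1 ∧ f.2 ≠ e.2))

theorem qopt_subset (I : MI P Q) : I.qopt ⊆ I.E := by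
  unfold qopt
  split
  · next h => exact h.choose_spec.1.1.1
  · exact Finset.empty_subset _

/-- the sequentially fixing deferred acceptance algorithm: repeatedly fix the pair of
`qopt` of the current instance that comes first in the offering order. -/
noncomputable def sfda (I : MI P Q) (σ : List (P × Q)) : Finset (P × Q) :=
  match h : σ.find? (fun f => decide (f ∈ I.qopt)) with
  | none => ∅
  | some e => insert e ((I.contr e).sfda (contrO σ e))
termination_by σ.length
decreasing_by
  have he : e ∈ σ := List.mem_of_find?_eq_some h
  have hfail : ¬ (fun f => decide (f.1 ≠ e.1 ∧ f.2 ≠ e.2)) e = true := by simp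
  exact List.length_filter_lt_length_iff_exists.mpr ⟨e, he, hfail⟩

open scoped Classical in
/-- the SPE matching `spe(I, σ)` of the sequential matching game `(I, σ)`. -/
noncomputable def spe (I : MI P Q) (σ : List (P × Q)) : Finset (P × Q) :=
  match σ with
  | [] => ∅
  | e :: rest =>
    if I.WBelow ((I.del e).spe rest) e.2 e.1
    then insert e ((I.contr e).spe (contrO rest e))
    else (I.del e).spe rest
termination_by σ.length
decreasing_by
  all_goals simp only [contrO, List.length_cons]
  all_goals first
    | omega
    | exact Nat.lt_succ_of_le (List.length_filter_le _ _)


/-! ## Helper lemmas -/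

theorem helper_mi_ext {I J : MI P Q} (h1 : I.E = J.E) (h2 : I.rankP = J.rankP)
    (h3 : I.rankQ = J.rankQ) : I = J := by
  cases I; cases J; simp only at h1 h2 h3; subst h1 h2 h3; rfl

theorem worker_unique {I : MI P Q} {μ : Finset (P × Q)} (h : I.IsMatching μ) {p p' : P} {q : Q}
    (h1 : (p, q) ∈ μ) (h2 : (p', q) ∈ μ) : p = p' :=
  congrArg Prod.fst (h.2 _ h1 _ h2 (Or.inr rfl))

theorem firm_unique {I : MI P Q} {μ : Finset (P × Q)} (h : I.IsMatching μ) {p : P} {q q' : Q}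
    (h1 : (p, q) ∈ μ) (h2 : (p, q') ∈ μ) : q = q' :=
  congrArg Prod.snd (h.2 _ h1 _ h2 (Or.inl rfl))

/-- Stable matchings that dominate each other are equal (one inclusion). -/
theorem dom_subset {I : MI P Q} {μ ν : Finset (P × Q)} (hμ : I.IsStable μ) (hν : I.IsStable ν)
    (h1 : ∀ q, I.WGe μ ν q) (h2 : ∀ q, I.WGe ν μ q) : μ ⊆ ν := by
  rintro ⟨p, q⟩ h
  obtain ⟨p', hp', h3⟩ := h2 q p h
  obtain ⟨p'', hp'', h4⟩ := h1 q p' hp'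
  have := worker_unique hμ.1 h hp''
  subst this
  rcases h3 with rfl | h3
  · exact hp'
  · rcases h4 with rfl | h4
    · exact hp'
    · omega

theorem qopt_unique {I : MI P Q} {μ ν : Finset (P × Q)} (hμ : I.IsQOpt μ) (hν : I.IsQOpt ν) :
    μ = ν :=
  Finset.Subset.antisymm (dom_subset hμ.1 hν.1 (hμ.2 _ hν.1) (hν.2 _ hμ.1))
    (dom_subset hν.1 hμ.1 (hν.2 _ hμ.1) (hμ.2 _ hν.1))

theorem stable_del_of_stable {I : MI P Q} {e : P × Q} {μ : Finset (P × Q)} (h : I.IsStable μ)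
    (he : e ∉ μ) : (I.del e).IsStable μ := by
  refine ⟨⟨fun f hf => Finset.mem_erase.2 ⟨?_, h.1.1 hf⟩, h.1.2⟩, ?_⟩
  · rintro rfl; exact he hf
  · intro f hf
    exact h.2 f ⟨Finset.mem_of_mem_erase hf.1, hf.2⟩

theorem stable_of_stable_del {I : MI P Q} {e : P × Q} {μ : Finset (P × Q)}
    (h : (I.del e).IsStable μ) (he : ¬ I.Blocks μ e) : I.IsStable μ := by
  refine ⟨⟨fun f hf => Finset.mem_of_mem_erase (h.1.1 hf), h.1.2⟩, ?_⟩
  intro f hf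
  by_cases hfe : f = e
  · exact he (hfe ▸ hf)
  · exact h.2 f ⟨Finset.mem_erase.2 ⟨hfe, hf.1⟩, hf.2⟩

/-- Gale–Shapley. -/
theorem exists_qopt (n : ℕ) : ∀ I : MI P Q, I.E.card = n → ∃ μ, I.IsQOpt μ := by
  induction n with
  | zero =>
    intro I hI
    have hE : I.E = ∅ := Finset.card_eq_zero.1 hI
    refine ⟨∅, ⟨⟨by simp, by simp⟩, ?_⟩, ?_⟩
    · intro e he
      have := he.1
      simp [hE] at this
    · intro μ' h' q p hp
      have := h'.1.1 hp
      simp [hE] at this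
  | succ n ih =>
    intro I hI
    by_cases hc : ∃ p q1 q2, I.TopForWorker q1 p ∧ I.TopForWorker q2 p ∧
        I.rankP p q1 < I.rankP p q2
    · obtain ⟨p, q1, q2, h1, h2, h12⟩ := hc
      have hcard : (I.del (p, q2)).E.card = n := by
        change (I.E.erase (p, q2)).card = n
        rw [Finset.card_erase_of_mem h2.1, hI]; rfl
      obtain ⟨μ, hμ⟩ := ih _ hcard
      have hne : (p, q1) ≠ (p, q2) := by
        intro h
        have : q1 = q2 := congrArg Prod.snd h
        subst this
        omega
      have hst : ∀ ν, I.IsStable ν → (I.del (p, q2)).IsStable ν := by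
        intro ν hν
        apply stable_del_of_stable hν
        intro hmem
        apply hν.2 (p, q1)
        refine ⟨h1.1, ?_, ?_⟩
        · intro q' hq'
          have := firm_unique hν.1 hmem hq'
          subst this
          exact h12
        · intro p' hp'
          have hE := hν.1.1 hp'
          have hle := h1.2 p' hE
          rcases Nat.lt_or_eq_of_le hle with h | h
          · exact h
          · exfalso
            have := I.injQ _ _ _ h1.1 hE h
            subst this
            exact hne (hν.1.2 _ hp' _ hmem (Or.inl rfl))
      refine ⟨μ, ⟨stable_of_stable_del hμ.1 ?_, fun ν hν => hμ.2 ν (hst ν hν)⟩⟩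
      rintro ⟨-, hF, hW⟩
      apply hμ.1.2 (p, q1)
      refine ⟨Finset.mem_erase.2 ⟨hne, h1.1⟩, ?_, ?_⟩
      · intro q' hq'
        exact h12.trans (hF q' hq')
      · intro p' hp'
        have hE := Finset.mem_of_mem_erase (hμ.1.1.1 hp')
        have hle := h1.2 p' hE
        rcases Nat.lt_or_eq_of_le hle with h | h
        · exact h
        · exfalso
          have := I.injQ _ _ _ h1.1 hE h
          subst this
          have := hF q1 hp'
          simp only [del] at this
          omega
    · classical
      have huniq : ∀ p q1 q2, I.TopForWorker q1 p → I.TopForWorker q2 p → q1 = q2 := by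
        intro p q1 q2 h1 h2
        by_contra hne
        have : I.rankP p q1 ≠ I.rankP p q2 := fun h => hne (I.injP _ _ _ h1.1 h2.1 h)
        rcases Nat.lt_or_gt_of_ne this with h | h
        · exact hc ⟨p, q1, q2, h1, h2, h⟩
        · exact hc ⟨p, q2, q1, h2, h1, h⟩
      have huniq' : ∀ q p1 p2, I.TopForWorker q p1 → I.TopForWorker q p2 → p1 = p2 := by
        intro q p1 p2 h1 h2
        exact I.injQ _ _ _ h1.1 h2.1 (le_antisymm (h1.2 _ h2.1) (h2.2 _ h1.1))
      have hex : ∀ p q, (p, q) ∈ I.E → ∃ p', I.TopForWorker q p' := by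
        intro p q h
        obtain ⟨f, hf, hmin⟩ := Finset.exists_min_image (I.E.filter (fun f => f.2 = q))
          (fun f => I.rankQ q f.1) ⟨(p, q), by simp [h]⟩
        obtain ⟨p', q'⟩ := f
        obtain ⟨hfE, hfq⟩ := Finset.mem_filter.1 hf
        simp only at hfq
        subst hfq
        exact ⟨p', hfE, fun p'' h'' => hmin (p'', q') (by simp [h''])⟩
      refine ⟨I.E.filter (fun f => I.TopForWorker f.2 f.1), ⟨⟨Finset.filter_subset _ _, ?_⟩, ?_⟩, ?_⟩
      · rintro ⟨p, q⟩ h1 ⟨p', q'⟩ h2 h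
        have h1 := (Finset.mem_filter.1 h1).2
        have h2 := (Finset.mem_filter.1 h2).2
        simp only at h h1 h2
        rcases h with rfl | rfl
        · rw [huniq _ _ _ h1 h2]
        · rw [huniq' _ _ _ h1 h2]
      · rintro ⟨p, q⟩ ⟨hE, -, hW⟩
        obtain ⟨p', hp'⟩ := hex p q hE
        have h1 := hW p' (Finset.mem_filter.2 ⟨hp'.1, hp'⟩)
        have h2 := hp'.2 p hE
        simp only at h1
        omega
      · intro ν hν q p hp
        have hE := hν.1.1 hp
        obtain ⟨p', hp'⟩ := hex p q hE
        refine ⟨p', Finset.mem_filter.2 ⟨hp'.1, hp'⟩, ?_⟩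
        rcases Nat.lt_or_eq_of_le (hp'.2 p hE) with h | h
        · exact Or.inr h
        · exact Or.inl (I.injQ _ _ _ hp'.1 hE h)

theorem isQOpt_qopt (I : MI P Q) : I.IsQOpt I.qopt := by
  have h := exists_qopt _ I rfl
  unfold qopt
  rw [dif_pos h]
  exact h.choose_spec

/-- Rural hospitals theorem, comparing any stable matching with the worker-optimal one. -/
theorem rural {I : MI P Q} {μ ν : Finset (P × Q)} (hμ : I.IsQOpt μ) (hν : I.IsStable ν) :
    μ.image Prod.fst = ν.image Prod.fst ∧ μ.image Prod.snd = ν.image Prod.snd := by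
  have hF : μ.image Prod.fst ⊆ ν.image Prod.fst := by
    intro p hp
    obtain ⟨⟨p', q⟩, hpq, rfl⟩ := Finset.mem_image.1 hp
    by_contra hcon
    have hun : ∀ q', (p', q') ∉ ν := fun q' h => hcon (Finset.mem_image.2 ⟨_, h, rfl⟩)
    apply hν.2 (p', q)
    refine ⟨hμ.1.1.1 hpq, fun q' h => absurd h (hun q'), ?_⟩
    intro p'' h''
    obtain ⟨p3, h3, h4⟩ := hμ.2 ν hν q p'' h''
    have := worker_unique hμ.1.1 hpq h3
    subst this
    rcases h4 with rfl | h4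
    · exact absurd h'' (hun q)
    · exact h4
  have hW : ν.image Prod.snd ⊆ μ.image Prod.snd := by
    intro q hq
    obtain ⟨⟨p, q'⟩, hpq, rfl⟩ := Finset.mem_image.1 hq
    obtain ⟨p3, h3, -⟩ := hμ.2 ν hν q' p hpq
    exact Finset.mem_image.2 ⟨_, h3, rfl⟩
  have c1 : ∀ ρ : Finset (P × Q), I.IsMatching ρ → (ρ.image Prod.fst).card = ρ.card := by
    intro ρ hρ
    exact Finset.card_image_of_injOn (fun x hx y hy h => hρ.2 x hx y hy (Or.inl h))
  have c2 : ∀ ρ : Finset (P × Q), I.IsMatching ρ → (ρ.image Prod.snd).card = ρ.card := by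
    intro ρ hρ
    exact Finset.card_image_of_injOn (fun x hx y hy h => hρ.2 x hx y hy (Or.inr h))
  have l1 := Finset.card_le_card hF
  have l2 := Finset.card_le_card hW
  rw [c1 _ hμ.1.1, c1 _ hν.1] at l1
  rw [c2 _ hμ.1.1, c2 _ hν.1] at l2
  constructor
  · apply Finset.eq_of_subset_of_card_le hF
    rw [c1 _ hμ.1.1, c1 _ hν.1]; exact l2
  · symm
    apply Finset.eq_of_subset_of_card_le hW
    rw [c2 _ hμ.1.1, c2 _ hν.1]; exact l1

theorem mem_contr {I : MI P Q} {e f : P × Q} :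
    f ∈ (I.contr e).E ↔ f ∈ I.E ∧ f.1 ≠ e.1 ∧ f.2 ≠ e.2 := Finset.mem_filter

theorem mem_del {I : MI P Q} {e f : P × Q} :
    f ∈ (I.del e).E ↔ f ≠ e ∧ f ∈ I.E := Finset.mem_erase

theorem mem_contrO {σ : List (P × Q)} {e f : P × Q} :
    f ∈ contrO σ e ↔ f ∈ σ ∧ f.1 ≠ e.1 ∧ f.2 ≠ e.2 := by
  simp [contrO]

theorem stable_contr {I : MI P Q} {μ : Finset (P × Q)} {f : P × Q} (h : I.IsStable μ)
    (hf : f ∈ μ) : (I.contr f).IsStable (μ.erase f) := by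
  refine ⟨⟨?_, ?_⟩, ?_⟩
  · intro g hg
    obtain ⟨hgf, hg⟩ := Finset.mem_erase.1 hg
    exact mem_contr.2 ⟨h.1.1 hg, fun h1 => hgf (h.1.2 _ hg _ hf (Or.inl h1)),
      fun h1 => hgf (h.1.2 _ hg _ hf (Or.inr h1))⟩
  · intro g hg g' hg'
    exact h.1.2 g (Finset.mem_of_mem_erase hg) g' (Finset.mem_of_mem_erase hg')
  · rintro g ⟨hgE, hF, hW⟩
    obtain ⟨hgE, h1, h2⟩ := mem_contr.1 hgE
    apply h.2 g
    refine ⟨hgE, fun q' hq' => hF q' (Finset.mem_erase.2 ⟨?_, hq'⟩),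
      fun p' hp' => hW p' (Finset.mem_erase.2 ⟨?_, hp'⟩)⟩
    · rintro rfl; exact h1 rfl
    · rintro rfl; exact h2 rfl

theorem contr_improve {I : MI P Q} {f : P × Q} (hf : f ∈ I.qopt) {p : P} {q : Q}
    (h : (p, q) ∈ I.qopt) (hq : f.2 ≠ q) :
    ∃ p', (p', q) ∈ (I.contr f).qopt ∧ I.rankQ q p' ≤ I.rankQ q p := by
  have hst := stable_contr (isQOpt_qopt I).1 hf
  obtain ⟨p', h1, h2⟩ := (isQOpt_qopt (I.contr f)).2 _ hst q p
    (Finset.mem_erase.2 ⟨by rintro rfl; exact hq rfl, h⟩)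
  refine ⟨p', h1, ?_⟩
  rcases h2 with rfl | h2
  · exact le_rfl
  · exact le_of_lt h2

theorem sfda_cases (I : MI P Q) (σ : List (P × Q)) :
    ((∀ f ∈ σ, f ∉ I.qopt) ∧ I.sfda σ = ∅) ∨
    ∃ e, e ∈ σ ∧ e ∈ I.qopt ∧ σ.find? (fun f => decide (f ∈ I.qopt)) = some e ∧
      I.sfda σ = insert e ((I.contr e).sfda (contrO σ e)) := by
  rw [sfda]
  split
  · next h =>
    left
    refine ⟨?_, rfl⟩
    intro f hf
    have := List.find?_eq_none.1 h f hf
    simpa using this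
  · next e h =>
    right
    refine ⟨e, List.mem_of_find?_eq_some h, ?_, h, rfl⟩
    have := List.find?_some h
    simpa using this

theorem contrO_length_lt {σ : List (P × Q)} {e : P × Q} (he : e ∈ σ) :
    (contrO σ e).length < σ.length :=
  List.length_filter_lt_length_iff_exists.mpr ⟨e, he, by simp⟩

theorem sfda_subset (n : ℕ) : ∀ (I : MI P Q) (σ : List (P × Q)), σ.length = n →
    I.sfda σ ⊆ I.E := by
  induction n using Nat.strong_induction_on with
  | _ n ih =>
    intro I σ hn
    rcases sfda_cases I σ with ⟨-, h⟩ | ⟨e, heσ, heq, -, h⟩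
    · rw [h]; exact Finset.empty_subset _
    · rw [h]
      intro f hf
      rcases Finset.mem_insert.1 hf with rfl | hf
      · exact qopt_subset I heq
      · exact (mem_contr.1 (ih _ (hn ▸ contrO_length_lt heσ) _ _ rfl hf)).1

theorem sfda_unmatched (q : Q) (n : ℕ) : ∀ (I : MI P Q) (σ : List (P × Q)), σ.length = n →
    q ∉ I.qopt.image Prod.snd → ∀ p, (p, q) ∉ I.sfda σ := by
  induction n using Nat.strong_induction_on with
  | _ n ih =>
    intro I σ hn hq p hp
    rcases sfda_cases I σ with ⟨-, h⟩ | ⟨e, heσ, heq, -, h⟩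
    · rw [h] at hp; simp at hp
    · rw [h] at hp
      rcases Finset.mem_insert.1 hp with rfl | hf
      · exact hq (Finset.mem_image.2 ⟨_, heq, rfl⟩)
      · refine ih _ (hn ▸ contrO_length_lt heσ) _ _ rfl ?_ p hf
        rw [(rural (isQOpt_qopt (I.contr e)) (stable_contr (isQOpt_qopt I).1 heq)).2]
        intro hm
        exact hq (Finset.image_subset_image (Finset.erase_subset _ _) hm)

theorem lists_contr {I : MI P Q} {σ : List (P × Q)} (e : P × Q) (h : ∀ f, f ∈ σ ↔ f ∈ I.E) :
    ∀ f, f ∈ contrO σ e ↔ f ∈ (I.contr e).E := by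
  intro f
  rw [mem_contrO, mem_contr, h]

theorem sfda_improve (q : Q) (n : ℕ) : ∀ (I : MI P Q) (σ : List (P × Q)), σ.length = n →
    (∀ f, f ∈ σ ↔ f ∈ I.E) → ∀ p, (p, q) ∈ I.qopt →
    ∃ p', (p', q) ∈ I.sfda σ ∧ I.rankQ q p' ≤ I.rankQ q p := by
  induction n using Nat.strong_induction_on with
  | _ n ih =>
    intro I σ hn hl p hp
    rcases sfda_cases I σ with ⟨h0, h⟩ | ⟨e, heσ, heq, -, h⟩
    · exact absurd hp (h0 _ ((hl _).2 (qopt_subset I hp)))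
    · rw [h]
      by_cases hq : e.2 = q
      · have : e = (p, q) := (isQOpt_qopt I).1.1.2 _ heq _ hp (Or.inr hq)
        exact ⟨p, by rw [this]; exact Finset.mem_insert_self _ _, le_rfl⟩
      · obtain ⟨p1, h1, h2⟩ := contr_improve heq hp hq
        obtain ⟨p2, h3, h4⟩ := ih _ (hn ▸ contrO_length_lt heσ) (I.contr e) _ rfl
          (lists_contr e hl) p1 h1
        exact ⟨p2, Finset.mem_insert_of_mem h3, le_trans h4 h2⟩

theorem deg_firm_mono {I J : MI P Q} (h : J.E ⊆ I.E) (hI : I.FirmsDegTwo) : J.FirmsDegTwo :=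
  fun p => (Finset.card_le_card (Finset.filter_subset_filter _ h)).trans (hI p)

theorem deg_worker_mono {I J : MI P Q} (h : J.E ⊆ I.E) (hI : I.WorkersDegTwo) :
    J.WorkersDegTwo :=
  fun q => (Finset.card_le_card (Finset.filter_subset_filter _ h)).trans (hI q)

theorem contr_sub (I : MI P Q) (e : P × Q) : (I.contr e).E ⊆ I.E := Finset.filter_subset _ _

theorem del_sub (I : MI P Q) (e : P × Q) : (I.del e).E ⊆ I.E := Finset.erase_subset _ _

theorem firm_three {I : MI P Q} (h : I.FirmsDegTwo) {p : P} {a b c : Q} (ha : (p, a) ∈ I.E)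
    (hb : (p, b) ∈ I.E) (hc : (p, c) ∈ I.E) (hab : a ≠ b) (hac : a ≠ c) (hbc : b ≠ c) :
    False := by
  have hsub : ({(p, a), (p, b), (p, c)} : Finset (P × Q)) ⊆ I.E.filter (fun f => f.1 = p) := by
    intro f hf
    simp only [Finset.mem_insert, Finset.mem_singleton] at hf
    rcases hf with rfl | rfl | rfl <;> simp [*]
  have h1 := (Finset.card_le_card hsub).trans (h p)
  have h2 : ({(p, a), (p, b), (p, c)} : Finset (P × Q)).card = 3 :=
    Finset.card_eq_three.2 ⟨_, _, _, by simpa using hab, by simpa using hac, by simpa using hbc,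
      rfl⟩
  omega

theorem worker_three {I : MI P Q} (h : I.WorkersDegTwo) {q : Q} {a b c : P} (ha : (a, q) ∈ I.E)
    (hb : (b, q) ∈ I.E) (hc : (c, q) ∈ I.E) (hab : a ≠ b) (hac : a ≠ c) (hbc : b ≠ c) :
    False := by
  have hsub : ({(a, q), (b, q), (c, q)} : Finset (P × Q)) ⊆ I.E.filter (fun f => f.2 = q) := by
    intro f hf
    simp only [Finset.mem_insert, Finset.mem_singleton] at hf
    rcases hf with rfl | rfl | rfl <;> simp [*]
  have h1 := (Finset.card_le_card hsub).trans (h q)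
  have h2 : ({(a, q), (b, q), (c, q)} : Finset (P × Q)).card = 3 :=
    Finset.card_eq_three.2 ⟨_, _, _, by simpa using hab, by simpa using hac, by simpa using hbc,
      rfl⟩
  omega

/-- In a (2,∞)-instance, contracting a pair of `qopt` does not change the rest of `qopt`. -/
theorem qopt_contr {I : MI P Q} (hd : I.FirmsDegTwo) {f : P × Q} (hf : f ∈ I.qopt) :
    insert f (I.contr f).qopt = I.qopt := by
  obtain ⟨pf, qf⟩ := f
  have hμ := isQOpt_qopt I
  have hν := isQOpt_qopt (I.contr (pf, qf))
  have hst := stable_contr hμ.1 hf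
  have hdom := hν.2 _ hst
  have hfirms := (rural hν hst).1
  have hmE : ∀ g ∈ (I.contr (pf, qf)).qopt, g ∈ I.E ∧ g.1 ≠ pf ∧ g.2 ≠ qf :=
    fun g hg => mem_contr.1 (hν.1.1.1 hg)
  have hmat : I.IsMatching (insert (pf, qf) (I.contr (pf, qf)).qopt) := by
    constructor
    · intro g hg
      rcases Finset.mem_insert.1 hg with rfl | hg
      · exact qopt_subset I hf
      · exact (hmE g hg).1
    · intro g hg g' hg' h
      rcases Finset.mem_insert.1 hg with rfl | hg
      · rcases Finset.mem_insert.1 hg' with rfl | hg'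
        · rfl
        · rcases h with h | h
          · exact absurd h.symm (hmE g' hg').2.1
          · exact absurd h.symm (hmE g' hg').2.2
      · rcases Finset.mem_insert.1 hg' with rfl | hg'
        · rcases h with h | h
          · exact absurd h (hmE g hg).2.1
          · exact absurd h (hmE g hg).2.2
        · exact hν.1.1.2 g hg g' hg' h
  have hstab : I.IsStable (insert (pf, qf) (I.contr (pf, qf)).qopt) := by
    refine ⟨hmat, ?_⟩
    rintro ⟨p, q⟩ ⟨hE, hF, hW⟩
    simp only at hF hW
    by_cases hp : p = pf
    · subst hp
      have hr := hF qf (Finset.mem_insert_self _ _)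
      have hq : qf ≠ q := by rintro rfl; omega
      apply hμ.1.2 (p, q)
      refine ⟨hE, ?_, ?_⟩
      · intro q' hq'
        have := firm_unique hμ.1.1 hf hq'
        subst this
        exact hr
      · intro p' hp'
        obtain ⟨p2, h1, h2⟩ := contr_improve hf hp' hq
        have := hW p2 (Finset.mem_insert_of_mem h1)
        simp only at h2 ⊢
        omega
    · by_cases hq : q = qf
      · subst hq
        have hr := hW pf (Finset.mem_insert_self _ _)
        -- `p` is matched in `qopt` to somebody better than `q`
        have hex : ∃ q1, (p, q1) ∈ I.qopt ∧ I.rankP p q1 ≤ I.rankP p q := by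
          by_contra hcon
          push Not at hcon
          apply hμ.1.2 (p, q)
          refine ⟨hE, hcon, ?_⟩
          intro p' hp'
          have := worker_unique hμ.1.1 hf hp'
          subst this
          exact hr
        obtain ⟨q1, h1, h2⟩ := hex
        have hq1 : q1 ≠ q := by
          rintro rfl
          exact hp (worker_unique hμ.1.1 h1 hf)
        have hpm : p ∈ (I.qopt.erase (pf, q)).image Prod.fst :=
          Finset.mem_image.2 ⟨(p, q1), Finset.mem_erase.2 ⟨by simp [hp], h1⟩, rfl⟩
        rw [← hfirms] at hpm
        obtain ⟨⟨p', q2⟩, h3, h4⟩ := Finset.mem_image.1 hpm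
        simp only at h4
        subst h4
        have h5 := hF q2 (Finset.mem_insert_of_mem h3)
        have h6 : q2 ≠ q := by rintro rfl; omega
        have h7 : q1 ≠ q2 := by rintro rfl; omega
        exact firm_three hd hE (qopt_subset I h1) (hmE _ h3).1 hq1.symm h6.symm h7
      · apply hν.1.2 (p, q)
        exact ⟨mem_contr.2 ⟨hE, hp, hq⟩, fun q' h => hF q' (Finset.mem_insert_of_mem h),
          fun p' h => hW p' (Finset.mem_insert_of_mem h)⟩
  have hge := hμ.2 _ hstab
  refine Finset.Subset.antisymm (dom_subset hstab hμ.1 ?_ hge) (dom_subset hμ.1 hstab hge ?_)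
  all_goals
    intro q p hp
    by_cases hq : qf = q
    · subst hq
      have := worker_unique hμ.1.1 hf hp
      subst this
      exact ⟨pf, Finset.mem_insert_self _ _, Or.inl rfl⟩
    · obtain ⟨p', h1, h2⟩ := hdom q p (Finset.mem_erase.2 ⟨by
        intro h
        exact hq (congrArg Prod.snd h).symm, hp⟩)
      exact ⟨p', Finset.mem_insert_of_mem h1, h2⟩

theorem sfda_eq_qopt (n : ℕ) : ∀ (I : MI P Q) (σ : List (P × Q)), σ.length = n →
    (∀ f, f ∈ σ ↔ f ∈ I.E) → I.FirmsDegTwo → I.sfda σ = I.qopt := by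
  induction n using Nat.strong_induction_on with
  | _ n ih =>
    intro I σ hn hl hd
    rcases sfda_cases I σ with ⟨h0, h⟩ | ⟨e, heσ, heq, -, h⟩
    · rw [h]
      symm
      apply Finset.eq_empty_of_forall_notMem
      intro f hf
      exact h0 f ((hl f).2 (qopt_subset I hf)) hf
    · rw [h, ih _ (hn ▸ contrO_length_lt heσ) (I.contr e) _ rfl (lists_contr e hl)
        (deg_firm_mono (contr_sub I e) hd), qopt_contr hd heq]

/-- Deleting a pair whose worker does strictly better in `qopt` does not change `qopt`. -/
theorem qopt_del {I : MI P Q} {p p' : P} {q : Q} (h : (p', q) ∈ I.qopt)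
    (hr : I.rankQ q p' < I.rankQ q p) : (I.del (p, q)).qopt = I.qopt := by
  have hμ := isQOpt_qopt I
  have hν := isQOpt_qopt (I.del (p, q))
  have hne : (p, q) ∉ I.qopt := by
    intro h'
    have := worker_unique hμ.1.1 h h'
    subst this
    omega
  have hst := stable_del_of_stable hμ.1 hne
  have hge := hν.2 _ hst
  have hst' : I.IsStable (I.del (p, q)).qopt := by
    apply stable_of_stable_del hν.1
    rintro ⟨-, -, hW⟩
    obtain ⟨p2, h1, h2⟩ := hge q p' h
    have h3 := hW p2 h1
    simp only at h3
    rcases h2 with rfl | h2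
    · omega
    · simp only [del] at h2
      omega
  have hge' := hμ.2 _ hst'
  exact Finset.Subset.antisymm (dom_subset hst' hμ.1 hge hge') (dom_subset hμ.1 hst' hge' hge)

theorem sfda_del (p : P) (q : Q) (n : ℕ) : ∀ (I : MI P Q) (rest : List (P × Q)),
    rest.length = n → (∃ p', (p', q) ∈ I.qopt ∧ I.rankQ q p' < I.rankQ q p) →
    I.sfda ((p, q) :: rest) = (I.del (p, q)).sfda rest := by
  induction n using Nat.strong_induction_on with
  | _ n ih =>
    intro I rest hn hp'
    obtain ⟨p', hp', hr⟩ := hp'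
    have hqd := qopt_del hp' hr
    have hne : (p, q) ∉ I.qopt := by
      intro h'
      have := worker_unique (isQOpt_qopt I).1.1 hp' h'
      subst this
      omega
    rcases sfda_cases (I.del (p, q)) rest with ⟨h0, h⟩ | ⟨e, heσ, heq, hfind, h⟩
    · rw [h]
      rcases sfda_cases I ((p, q) :: rest) with ⟨h0', h'⟩ | ⟨e', heσ', heq', -, -⟩
      · exact h'
      · exfalso
        rcases List.mem_cons.1 heσ' with rfl | hm
        · exact hne heq'
        · exact h0 _ hm (hqd ▸ heq')
    · rw [h]
      rw [hqd] at hfind heq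
      have hfind2 : ((p, q) :: rest).find? (fun f => decide (f ∈ I.qopt)) = some e := by
        rw [List.find?_cons_of_neg (by simpa using hne)]
        exact hfind
      rcases sfda_cases I ((p, q) :: rest) with ⟨h0', -⟩ | ⟨e', heσ', heq', hfind', h'⟩
      · exact absurd heq (h0' e (List.mem_cons_of_mem _ heσ))
      · rw [hfind2] at hfind'
        obtain rfl : e = e' := Option.some.inj hfind'
        rw [h']
        congr 1
        by_cases hdis : p ≠ e.1 ∧ q ≠ e.2
        · have hc : contrO ((p, q) :: rest) e = (p, q) :: contrO rest e := by
            simp only [contrO]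
            rw [List.filter_cons_of_pos (by simpa using hdis)]
          have hI : (I.del (p, q)).contr e = (I.contr e).del (p, q) := by
            refine helper_mi_ext ?_ rfl rfl
            ext f
            rw [mem_contr, mem_del, mem_del, mem_contr]
            tauto
          rw [hc, hI]
          obtain ⟨p1, h1, h2⟩ := contr_improve heq hp' hdis.2.symm
          exact ih _ (hn ▸ contrO_length_lt heσ) (I.contr e) _ rfl
            ⟨p1, h1, lt_of_le_of_lt h2 hr⟩
        · have hc : contrO ((p, q) :: rest) e = contrO rest e := by
            simp only [contrO]
            rw [List.filter_cons_of_neg (by simpa using hdis)]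
          have hI : (I.del (p, q)).contr e = I.contr e := by
            refine helper_mi_ext ?_ rfl rfl
            ext f
            rw [mem_contr, mem_contr, mem_del]
            constructor
            · rintro ⟨⟨-, h1⟩, h2⟩; exact ⟨h1, h2⟩
            · rintro ⟨h1, h2⟩
              exact ⟨⟨by rintro rfl; exact hdis h2, h1⟩, h2⟩
          rw [hc, hI]

/-- If the pair belongs to `qopt`, its worker does worse in `qopt` after its deletion. -/
theorem qopt_del_worse {I : MI P Q} {p p' : P} {q : Q} (h : (p, q) ∈ I.qopt)
    (h' : (p', q) ∈ (I.del (p, q)).qopt) : I.rankQ q p < I.rankQ q p' := by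
  have hμ := isQOpt_qopt I
  have hν := isQOpt_qopt (I.del (p, q))
  obtain ⟨hne, hE⟩ := mem_del.1 (hν.1.1.1 h')
  by_contra hcon
  have hst : I.IsStable (I.del (p, q)).qopt := by
    apply stable_of_stable_del hν.1
    rintro ⟨-, -, hW⟩
    exact hcon (hW p' h')
  obtain ⟨p2, h1, h2⟩ := hμ.2 _ hst q p' h'
  have := worker_unique hμ.1.1 h h1
  subst this
  rcases h2 with rfl | h2
  · exact hne rfl
  · exact hcon h2

theorem main_aux (n : ℕ) : ∀ (I : MI P Q) (σ : List (P × Q)), σ.length = n →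
    (I.FirmsDegTwo ∨ I.WorkersDegTwo) → σ.Nodup → (∀ f, f ∈ σ ↔ f ∈ I.E) →
    σ.Pairwise (fun e f => e.1 = f.1 → I.rankP e.1 e.2 ≤ I.rankP f.1 f.2) →
    I.sfda σ = I.spe σ := by
  induction n using Nat.strong_induction_on with
  | _ n ih =>
    intro I σ hn hdeg hnd hl hpw
    cases σ with
    | nil =>
      rcases sfda_cases I [] with ⟨-, h⟩ | ⟨e, he, -⟩
      · rw [h, spe]
      · simp at he
    | cons e rest =>
      obtain ⟨p, q⟩ := e
      obtain ⟨hnm, hnd'⟩ := List.nodup_cons.1 hnd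
      obtain ⟨htop, hpw'⟩ := List.pairwise_cons.1 hpw
      have hlen : rest.length < n := by rw [← hn]; simp
      have hE : (p, q) ∈ I.E := (hl _).1 List.mem_cons_self
      have hldel : ∀ f, f ∈ rest ↔ f ∈ (I.del (p, q)).E := by
        intro f
        rw [mem_del, ← hl, List.mem_cons]
        constructor
        · intro h
          exact ⟨by rintro rfl; exact hnm h, Or.inr h⟩
        · rintro ⟨h1, h2 | h2⟩
          · exact absurd h2 h1
          · exact h2
      have hlc : ∀ f, f ∈ contrO rest (p, q) ↔ f ∈ (I.contr (p, q)).E := by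
        intro f
        rw [mem_contrO, mem_contr, ← hl, List.mem_cons]
        constructor
        · rintro ⟨h1, h2⟩; exact ⟨Or.inr h1, h2⟩
        · rintro ⟨h1 | h1, h2⟩
          · subst h1; exact absurd rfl h2.1
          · exact ⟨h1, h2⟩
      have hddel : (I.del (p, q)).FirmsDegTwo ∨ (I.del (p, q)).WorkersDegTwo :=
        hdeg.imp (deg_firm_mono (del_sub _ _)) (deg_worker_mono (del_sub _ _))
      have hdc : (I.contr (p, q)).FirmsDegTwo ∨ (I.contr (p, q)).WorkersDegTwo :=
        hdeg.imp (deg_firm_mono (contr_sub _ _)) (deg_worker_mono (contr_sub _ _))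
      have ih1 := ih _ hlen (I.del (p, q)) rest rfl hddel hnd' hldel hpw'
      have hlen2 : (contrO rest (p, q)).length < n :=
        lt_of_le_of_lt (List.length_filter_le _ _) hlen
      have ih2 := ih _ hlen2 (I.contr (p, q)) (contrO rest (p, q)) rfl hdc
        (hnd'.filter _) hlc (hpw'.filter _)
      rw [spe, ← ih1, ← ih2]
      by_cases hq : (p, q) ∈ I.qopt
      · rw [if_pos]
        · rcases sfda_cases I ((p, q) :: rest) with ⟨h0, -⟩ | ⟨e, -, -, hfind, h⟩
          · exact absurd hq (h0 _ List.mem_cons_self)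
          · rw [List.find?_cons_of_pos (by simpa using hq)] at hfind
            obtain rfl : (p, q) = e := Option.some.inj hfind
            rw [h]
            congr 2
            simp [contrO]
        · intro p' hp'
          simp only at hp' ⊢
          rcases hdeg with hd | hd
          · rw [sfda_eq_qopt _ _ _ rfl hldel (deg_firm_mono (del_sub _ _) hd)] at hp'
            exact qopt_del_worse hq hp'
          · by_cases hm : q ∈ (I.del (p, q)).qopt.image Prod.snd
            · obtain ⟨⟨p2, q2⟩, h2, h3⟩ := Finset.mem_image.1 hm
              simp only at h3
              subst h3
              have hr := qopt_del_worse hq h2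
              obtain ⟨n1, e1⟩ := mem_del.1 (qopt_subset _ h2)
              obtain ⟨n2, e2⟩ := mem_del.1 (sfda_subset _ _ _ rfl hp')
              by_cases hpp : p2 = p'
              · rw [← hpp]; exact hr
              · exfalso
                refine worker_three hd hE e1 e2 ?_ ?_ hpp
                · rintro rfl; exact n1 rfl
                · rintro rfl; exact n2 rfl
            · exact absurd hp' (sfda_unmatched q _ _ _ rfl hm p')
      · have hex : ∃ p', (p', q) ∈ I.qopt ∧ I.rankQ q p' < I.rankQ q p := by
          by_contra hcon
          push Not at hcon
          apply (isQOpt_qopt I).1.2 (p, q)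
          refine ⟨hE, ?_, ?_⟩
          · intro q' hq'
            have hE' := qopt_subset I hq'
            have hne : (p, q') ≠ (p, q) := by
              intro h; exact hq (h ▸ hq')
            have hm : (p, q') ∈ rest := (hldel _).2 (mem_del.2 ⟨hne, hE'⟩)
            rcases Nat.lt_or_eq_of_le (htop _ hm rfl) with h | h
            · exact h
            · exact absurd (by rw [I.injP _ _ _ hE hE' h]) hne
          · intro p' hp'
            rcases Nat.lt_or_eq_of_le (hcon p' hp') with h | h
            · exact h
            · have := I.injQ _ _ _ hE (qopt_subset I hp') h
              subst this
              exact absurd hp' hq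
        rw [if_neg]
        · exact sfda_del p q _ I rest rfl hex
        · intro hW
          obtain ⟨p', hp', hr⟩ := hex
          rw [← qopt_del hp' hr] at hp'
          obtain ⟨p2, h2, h3⟩ := sfda_improve q _ _ _ rfl hldel p' hp'
          have h4 := hW p2 h2
          simp only [del] at h3 h4
          omega

/-- in a (2,∞)- or (∞,2)-instance, `sfda(I, σ) = spe(I, σ)`
for every offering order `σ`. -/
theorem stmt_10 (P Q : Type) [DecidableEq P] [DecidableEq Q] (I : MI P Q)
    (hdeg : I.FirmsDegTwo ∨ I.WorkersDegTwo)
    (σ : List (P × Q)) (hσ : I.IsOfferOrder σ) :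
    I.sfda σ = I.spe σ := by
  refine main_aux _ I σ rfl hdeg hσ.1 hσ.2.1 ?_
  rw [List.pairwise_iff_getElem]
  intro i j hi hj hij h
  by_contra hcon
  have h1 := hσ.2.2 _ _ (List.getElem_mem hj) (List.getElem_mem hi) h.symm (not_le.1 hcon)
  rw [hσ.1.idxOf_getElem, hσ.1.idxOf_getElem] at h1
  omega

end MI

end SeqMatching
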